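/- Let λ > 0, η > 0, 0 < β < 1 and T̲ > 0, and let g : ℝ → ℝ be bounded on [T̲, ∞). Define m : ℝ → ℝ by m(T) = λT²/2 + g(T) + β^T · ∑_{k=0}^{∞} e^{−λT} (λT)^k / k! · √(2η k(k+1)). Suppose c* ∈ ℝ satisfies c* = inf_{T ≥ T̲} ( m(T) + β^T c* ), and define v : ℕ → ℝ by v(x) = √(2η x(x+1)) + c*. Then for every natural number x ≥ 1, a pair (a, T) with a ∈ (0, ∞) and T ∈ [T̲, ∞) attains the infimum of (a, T) ↦ x(x+1)/(2a) + ηa + λT²/2 + β^T · ∑_{k=0}^{∞} e^{−λT} (λT)^k / k! · v(k) + g(T) if and only if a = √(x(x+1)/(2η)) and T attains the infimum of T' ↦ m(T') + β^{T'} c* over [T̲, ∞). In particular, the set of optimal observation times T*_x is the same for every state x ≥ 1. -/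

import Mathlib

open Real

theorem eq_sInf_image_iff_isMinOn {α : Type*} {f : α → ℝ} {s : Set α} {x : α}
    (hf : BddBelow (f '' s)) (hx : x ∈ s) : f x = sInf (f '' s) ↔ IsMinOn f s x := by
  rw [isMinOn_iff]
  constructor
  · intro h y hy
    exact h.trans_le (csInf_le hf (Set.mem_image_of_mem f hy))
  · intro h
    refine le_antisymm (le_csInf ⟨_, Set.mem_image_of_mem f hx⟩ ?_)
      (csInf_le hf (Set.mem_image_of_mem f hx))
    rintro _ ⟨y, hy, rfl⟩
    exact h y hy

theorem add_eq_sInf_image_prod_iff {α γ : Type*} {f : α → ℝ} {g : γ → ℝ} {s : Set α} {t : Set γ}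
    {x : α} {y : γ} (hf : BddBelow (f '' s)) (hg : BddBelow (g '' t)) (hx : x ∈ s) (hy : y ∈ t) :
    f x + g y = sInf ((fun p : α × γ => f p.1 + g p.2) '' (s ×ˢ t)) ↔
      IsMinOn f s x ∧ g y = sInf (g '' t) := by
  have hbdd : BddBelow ((fun p : α × γ => f p.1 + g p.2) '' (s ×ˢ t)) := by
    obtain ⟨b, hb⟩ := hf
    obtain ⟨c, hc⟩ := hg
    refine ⟨b + c, ?_⟩
    rintro _ ⟨p, hp, rfl⟩
    exact add_le_add (hb (Set.mem_image_of_mem f hp.1)) (hc (Set.mem_image_of_mem g hp.2))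
  rw [eq_sInf_image_iff_isMinOn (f := fun p : α × γ => f p.1 + g p.2) (x := (x, y)) hbdd
      (Set.mk_mem_prod hx hy),
    eq_sInf_image_iff_isMinOn hg hy]
  simp only [isMinOn_iff]
  constructor
  · refine fun h => ⟨fun x' hx' => ?_, fun y' hy' => ?_⟩
    · exact le_of_add_le_add_right (h (x', y) (Set.mk_mem_prod hx' hy))
    · exact le_of_add_le_add_left (h (x, y') (Set.mk_mem_prod hx hy'))
  · rintro ⟨h₁, h₂⟩ p hp
    exact add_le_add (h₁ p.1 hp.1) (h₂ p.2 hp.2)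

theorem isMinOn_div_add_mul_iff {N η a : ℝ} (hN : 0 < N) (hη : 0 < η) (ha : 0 < a) :
    IsMinOn (fun b : ℝ => N / (2 * b) + η * b) (Set.Ioi 0) a ↔ a = √(N / (2 * η)) := by
  set r := √(N / (2 * η)) with hr
  have hr0 : 0 < r := Real.sqrt_pos.2 (by positivity)
  have hNr : N = 2 * η * r ^ 2 := by
    rw [hr, Real.sq_sqrt (by positivity)]
    field_simp
  have key : ∀ b : ℝ, 0 < b →
      N / (2 * b) + η * b = N / (2 * r) + η * r + η * (b - r) ^ 2 / b := by
    intro b hb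
    rw [hNr]
    field_simp
    ring
  rw [isMinOn_iff]
  constructor
  · intro h
    have h1 := h r hr0
    rw [key a ha] at h1
    by_contra hne
    have : 0 < η * (a - r) ^ 2 / a := by
      have := sub_ne_zero.2 hne
      positivity
    linarith
  · rintro rfl b hb
    rw [key b hb]
    have hb' : 0 < b := hb
    have : 0 ≤ η * (b - r) ^ 2 / b := by positivity
    linarith

theorem hasSum_poisson_weights (μ : ℝ) :
    HasSum (fun k : ℕ => exp (-μ) * μ ^ k / (Nat.factorial k)) 1 := by
  have h := (NormedSpace.expSeries_div_hasSum_exp μ).mul_left (exp (-μ))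
  rw [← Real.exp_eq_exp_ℝ, ← Real.exp_add, neg_add_cancel, Real.exp_zero] at h
  simpa only [mul_div_assoc] using h

theorem summable_poisson_weights_mul_sqrt {μ c : ℝ} (hμ : 0 ≤ μ) (hc : 0 ≤ c) :
    Summable fun k : ℕ => exp (-μ) * μ ^ k / (Nat.factorial k) *
      √(c * ((k : ℝ) * ((k : ℝ) + 1))) := by
  have hs : Summable fun k : ℕ => exp (-μ) * √c * ((2 * μ) ^ k / (Nat.factorial k)) :=
    (Real.summable_pow_div_factorial (2 * μ)).mul_left _
  refine hs.of_nonneg_of_le (fun k => by positivity) fun k => ?_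
  have hk : ((k : ℝ) + 1) ≤ 2 ^ k := by exact_mod_cast Nat.lt_two_pow_self (n := k)
  have h1 : √(c * ((k : ℝ) * ((k : ℝ) + 1))) ≤ √c * 2 ^ k := by
    rw [Real.sqrt_mul hc]
    gcongr
    rw [Real.sqrt_le_left (by positivity)]
    nlinarith [(Nat.cast_nonneg k : (0 : ℝ) ≤ k)]
  calc _ ≤ exp (-μ) * μ ^ k / (Nat.factorial k) * (√c * 2 ^ k) := by gcongr
    _ = _ := by rw [mul_pow]; ring

/-- **Characterization of the optimal policy for the gated queueing system.**
Under the setup of the dynamic programming equation (arrival rate `λ`, server cost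
`ηa`, discount `β`, minimum gap `T̲`, observation cost `g`, value function
`v(x) = √(2η x(x+1)) + c*`), for every state `x ≥ 1` a pair `(a, T)` with `a > 0`
and `T ≥ T̲` attains the infimum of the Bellman objective if and only if
`a = √(x(x+1)/(2η))` and `T` attains the infimum of `T' ↦ m T' + β^{T'} c*` over
`[T̲, ∞)`.  In particular the optimal observation times are state-independent. -/
theorem gated_queue_optimal_policy
    (lam η β Tmin : ℝ) (hlam : 0 < lam) (hη : 0 < η)
    (hβ0 : 0 < β) (hβ1 : β < 1) (hT : 0 < Tmin)
    (g : ℝ → ℝ) (hg : ∃ C : ℝ, ∀ T ≥ Tmin, |g T| ≤ C)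
    (m : ℝ → ℝ)
    (hm : ∀ T : ℝ, m T = lam * T ^ 2 / 2 + g T +
        β ^ T * ∑' k : ℕ, exp (-(lam * T)) * (lam * T) ^ k / (Nat.factorial k) *
          Real.sqrt (2 * η * ((k : ℝ) * ((k : ℝ) + 1))))
    (cstar : ℝ)
    (hc : cstar = sInf ((fun T => m T + β ^ T * cstar) '' Set.Ici Tmin))
    (v : ℕ → ℝ)
    (hv : ∀ x : ℕ, v x = Real.sqrt (2 * η * ((x : ℝ) * ((x : ℝ) + 1))) + cstar) :
    ∀ x : ℕ, 1 ≤ x → ∀ a ∈ Set.Ioi (0 : ℝ), ∀ T ∈ Set.Ici Tmin,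
      ((x : ℝ) * ((x : ℝ) + 1) / (2 * a) + η * a + lam * T ^ 2 / 2 +
          β ^ T * (∑' k : ℕ,
            exp (-(lam * T)) * (lam * T) ^ k / (Nat.factorial k) * v k) + g T =
        sInf ((fun p : ℝ × ℝ =>
          (x : ℝ) * ((x : ℝ) + 1) / (2 * p.1) + η * p.1 + lam * p.2 ^ 2 / 2 +
            β ^ p.2 * (∑' k : ℕ,
              exp (-(lam * p.2)) * (lam * p.2) ^ k / (Nat.factorial k) * v k) +
            g p.2) '' (Set.Ioi 0 ×ˢ Set.Ici Tmin)))
      ↔ (a = Real.sqrt ((x : ℝ) * ((x : ℝ) + 1) / (2 * η)) ∧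
          m T + β ^ T * cstar =
            sInf ((fun T' => m T' + β ^ T' * cstar) '' Set.Ici Tmin)) := by
  intro x hx a ha T hTm
  have hx0 : (0 : ℝ) < x := by exact_mod_cast hx
  have hN : (0 : ℝ) < (x : ℝ) * ((x : ℝ) + 1) := by positivity
  have hG : BddBelow ((fun T => m T + β ^ T * cstar) '' Set.Ici Tmin) := by
    obtain ⟨C, hC⟩ := hg
    refine ⟨-C - |cstar|, ?_⟩
    rintro _ ⟨S, hS, rfl⟩
    have hS0 : 0 < S := hT.trans_le hS
    have hpow : 0 < β ^ S := rpow_pos_of_pos hβ0 S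
    have hpow1 : β ^ S ≤ 1 := rpow_le_one hβ0.le hβ1.le hS0.le
    have hsum : 0 ≤ ∑' k : ℕ, exp (-(lam * S)) * (lam * S) ^ k / (Nat.factorial k) *
        √(2 * η * ((k : ℝ) * ((k : ℝ) + 1))) := tsum_nonneg fun k => by positivity
    have h1 := mul_nonneg hpow.le hsum
    have h2 : 0 ≤ lam * S ^ 2 / 2 := by positivity
    have h3 := (abs_le.1 (hC S hS)).1
    have h4 : -|cstar| ≤ β ^ S * cstar := by
      nlinarith [neg_abs_le cstar, abs_nonneg cstar]
    simp only [hm]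
    linarith
  have hF : BddBelow ((fun b : ℝ => (x : ℝ) * ((x : ℝ) + 1) / (2 * b) + η * b) '' Set.Ioi 0) := by
    refine ⟨0, ?_⟩
    rintro _ ⟨b, hb, rfl⟩
    have hb' : 0 < b := hb
    positivity
  have hsplit : ∀ b : ℝ, ∀ S ∈ Set.Ici Tmin,
      (x : ℝ) * ((x : ℝ) + 1) / (2 * b) + η * b + lam * S ^ 2 / 2 +
        β ^ S * (∑' k : ℕ, exp (-(lam * S)) * (lam * S) ^ k / (Nat.factorial k) * v k) + g S =
      ((x : ℝ) * ((x : ℝ) + 1) / (2 * b) + η * b) + (m S + β ^ S * cstar) := by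
    intro b S hS
    have hS0 : 0 < S := hT.trans_le hS
    have hw := hasSum_poisson_weights (lam * S)
    simp only [hv, mul_add (exp _ * _ / _)]
    rw [(summable_poisson_weights_mul_sqrt (by positivity) (by positivity)).tsum_add
      (hw.summable.mul_right cstar), tsum_mul_right, hw.tsum_eq, hm]
    ring
  rw [hsplit a T hTm, Set.image_congr fun p hp => hsplit p.1 p.2 hp.2,
    add_eq_sInf_image_prod_iff (f := fun b : ℝ => (x : ℝ) * ((x : ℝ) + 1) / (2 * b) + η * b)
      (g := fun S => m S + β ^ S * cstar) hF hG ha hTm,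
    isMinOn_div_add_mul_iff hN hη ha]
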